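/- Let g ≥ 2 be an integer, α the unique real root greater than 1 of x³ − x² − 1, and a = α²/(α³ + 2). If integers k ≥ 1, digits 1 ≤ d₁, d₂, d₃, d₄ ≤ g − 1 and exponents 1 ≤ ℓ ≤ m ≤ n ≤ t with t ≥ 2 satisfy N_k = d₁(gˡ−1)/(g−1) · d₂(gᵐ−1)/(g−1) · d₃(gⁿ−1)/(g−1) · d₄(gᵗ−1)/(g−1), then |a·(g−1)⁴/(d₁d₂d₃d₄·(gˡ−1)(gᵐ−1)) · α^k · g^{−(n+t)} − 1| < 4/gⁿ. -/

import Mathlib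

/-- The Narayana sequence: N₀ = 0, N₁ = N₂ = 1, Nₙ = Nₙ₋₁ + Nₙ₋₃. -/
def narayana : ℕ → ℕ
  | 0 => 0
  | 1 => 1
  | 2 => 1
  | n + 3 => narayana (n + 2) + narayana n

theorem nar_rel (α : ℝ) (hroot : α ^ 3 = α ^ 2 + 1) (n : ℕ) :
    (narayana (n + 2) : ℝ) + (α - 1) * narayana (n + 1) + α * (α - 1) * narayana n
      = α ^ (n + 1) := by
  induction n with
  | zero => simp [narayana]
  | succ n ih =>
    have h : (narayana (n + 1 + 2) : ℝ) = narayana (n + 2) + narayana n := by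
      have : narayana (n + 3) = narayana (n + 2) + narayana n := by rw [narayana]
      exact_mod_cast this
    rw [h, pow_succ, ← ih]
    linear_combination (-(narayana n : ℝ)) * hroot

theorem root_bounds (α : ℝ) (hα : 1 < α) (hroot : α ^ 3 = α ^ 2 + 1) :
    1.46 < α ∧ α < 1.47 := by
  constructor
  · by_contra! h
    nlinarith [mul_nonneg (sub_nonneg.2 h) (sq_nonneg α), mul_nonneg (sub_nonneg.2 h) (sub_nonneg.2 hα.le)]
  · by_contra! h
    nlinarith [mul_nonneg (sub_nonneg.2 h) (sq_nonneg α), mul_nonneg (sub_nonneg.2 h) (sub_nonneg.2 hα.le)]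

theorem err_bound (α : ℝ) (hα : 1 < α) (hroot : α ^ 3 = α ^ 2 + 1)
    (a : ℝ) (ha : a = α ^ 2 / (α ^ 3 + 2)) (k : ℕ) :
    |(narayana k : ℝ) - a * α ^ k| ≤ 1 := by
  obtain ⟨hl, hu⟩ := root_bounds α hα hroot
  have ha1 : a * (3 * α - 2) = 1 := by
    have : α ^ 3 + 2 ≠ 0 := by positivity
    rw [ha]; field_simp; linear_combination 2 * hroot
  have hal : 0.4 < a := by
    by_contra! h
    nlinarith
  have hau : a < 0.43 := by
    by_contra! h
    nlinarith
  have hrec : ∀ n : ℕ, ((narayana (n + 2) : ℝ) - a * α ^ (n + 2))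
      = -(α - 1) * ((narayana (n + 1) : ℝ) - a * α ^ (n + 1))
        - α * (α - 1) * ((narayana n : ℝ) - a * α ^ n) := by
    intro n
    have h := nar_rel α hroot n
    linear_combination h - α ^ (n + 1) * ha1
  have hc0 : 0.67 < α * (α - 1) := by nlinarith
  have hc1 : α * (α - 1) < 1 := by nlinarith
  have hQ : ∀ n : ℕ, ((narayana (n + 1) : ℝ) - a * α ^ (n + 1)) ^ 2
      + (α - 1) * ((narayana (n + 1) : ℝ) - a * α ^ (n + 1)) * ((narayana n : ℝ) - a * α ^ n)
      + α * (α - 1) * ((narayana n : ℝ) - a * α ^ n) ^ 2 ≤ 0.4 := by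
    intro n
    induction n with
    | zero =>
      simp only [narayana, zero_add, pow_zero, pow_one, Nat.cast_one, Nat.cast_zero]
      have h1 : 0.58 < a * α := by nlinarith
      have h2 : a * α < 0.64 := by nlinarith
      have h3 : (1 - a * α) ^ 2 ≤ 0.18 := by nlinarith
      have h4 : 0 ≤ (α - 1) * (1 - a * α) * a :=
        mul_nonneg (mul_nonneg (by linarith) (by linarith)) (by linarith)
      have h5 : a ^ 2 ≤ 0.19 := by nlinarith
      have h6 : α * (α - 1) * a ^ 2 ≤ 1 * a ^ 2 :=
        mul_le_mul_of_nonneg_right hc1.le (sq_nonneg a)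
      linarith
    | succ n ih =>
      rw [show n + 1 + 1 = n + 2 from rfl, hrec n]
      generalize (narayana (n + 1) : ℝ) - a * α ^ (n + 1) = x at *
      generalize (narayana n : ℝ) - a * α ^ n = y at *
      generalize α * (α - 1) = c at *
      have := mul_le_mul_of_nonneg_left ih (by linarith : 0 ≤ c)
      linarith
  have h := hQ k
  generalize (narayana (k + 1) : ℝ) - a * α ^ (k + 1) = x at *
  generalize (narayana k : ℝ) - a * α ^ k = y at *
  have h1 : (α - 1) ^ 2 ≤ 0.25 := by nlinarith
  have h2 := mul_le_mul_of_nonneg_right h1 (sq_nonneg y)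
  have h3 := mul_le_mul_of_nonneg_right hc0.le (sq_nonneg y)
  rw [← sq_le_one_iff_abs_le_one]
  nlinarith [sq_nonneg (x + (α - 1) / 2 * y)]

theorem lambda_three_bound (α : ℝ) (hα : 1 < α) (hroot : α ^ 3 = α ^ 2 + 1)
    (a : ℝ) (ha : a = α ^ 2 / (α ^ 3 + 2))
    (g k d₁ d₂ d₃ d₄ ℓ m n t : ℕ) (hg : 2 ≤ g) (hk : 1 ≤ k)
    (hd₁ : 1 ≤ d₁) (hd₁g : d₁ ≤ g - 1) (hd₂ : 1 ≤ d₂) (hd₂g : d₂ ≤ g - 1)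
    (hd₃ : 1 ≤ d₃) (hd₃g : d₃ ≤ g - 1) (hd₄ : 1 ≤ d₄) (hd₄g : d₄ ≤ g - 1)
    (hℓ : 1 ≤ ℓ) (hℓm : ℓ ≤ m) (hmn : m ≤ n) (hnt : n ≤ t) (ht : 2 ≤ t)
    (heq : narayana k * (g - 1) ^ 4 =
      d₁ * d₂ * d₃ * d₄ * (g ^ ℓ - 1) * (g ^ m - 1) * (g ^ n - 1) * (g ^ t - 1)) :
    |a * ((g : ℝ) - 1) ^ 4 /
        ((d₁ : ℝ) * d₂ * d₃ * d₄ * ((g : ℝ) ^ ℓ - 1) * ((g : ℝ) ^ m - 1)) * α ^ k *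
      (g : ℝ) ^ (-((n : ℤ) + t)) - 1| < 4 / (g : ℝ) ^ n := by
  have herr := err_bound α hα hroot a ha k
  have hg1 : 1 ≤ g := by omega
  have hp : ∀ i : ℕ, 1 ≤ g ^ i := fun i => Nat.one_le_pow _ _ (by omega)
  have hE : (narayana k : ℝ) * ((g : ℝ) - 1) ^ 4 =
      (d₁ : ℝ) * d₂ * d₃ * d₄ * ((g : ℝ) ^ ℓ - 1) * ((g : ℝ) ^ m - 1) *
        ((g : ℝ) ^ n - 1) * ((g : ℝ) ^ t - 1) := by
    have := congrArg (Nat.cast : ℕ → ℝ) heq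
    push_cast [Nat.cast_sub hg1, Nat.cast_sub (hp _)] at this
    exact this
  have hgR : (2 : ℝ) ≤ g := by exact_mod_cast hg
  have hge : ∀ i : ℕ, 1 ≤ i → (g : ℝ) - 1 ≤ (g : ℝ) ^ i - 1 := by
    intro i hi
    have := le_self_pow₀ (by linarith : (1 : ℝ) ≤ g) (by omega : i ≠ 0)
    linarith
  have hd : (1 : ℝ) ≤ (d₁ : ℝ) * d₂ * d₃ * d₄ := by
    have : 1 ≤ d₁ * d₂ * d₃ * d₄ := by
      have : 0 < d₁ * d₂ * d₃ * d₄ := by positivity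
      omega
    exact_mod_cast this
  have hD : ((g : ℝ) - 1) ^ 2 ≤
      (d₁ : ℝ) * d₂ * d₃ * d₄ * ((g : ℝ) ^ ℓ - 1) * ((g : ℝ) ^ m - 1) := by
    have h1 := hge ℓ hℓ
    have h2 := hge m (by omega)
    calc ((g : ℝ) - 1) ^ 2 = 1 * ((g : ℝ) - 1) * ((g : ℝ) - 1) := by ring
      _ ≤ _ := by
        have : (0 : ℝ) ≤ (g : ℝ) - 1 := by linarith
        have h3 : (0 : ℝ) ≤ (d₁ : ℝ) * d₂ * d₃ * d₄ * ((g : ℝ) ^ ℓ - 1) :=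
          mul_nonneg (by linarith) (by linarith)
        gcongr
  generalize (d₁ : ℝ) * d₂ * d₃ * d₄ * ((g : ℝ) ^ ℓ - 1) * ((g : ℝ) ^ m - 1) = D at *
  have hb : (1 : ℝ) ≤ ((g : ℝ) - 1) ^ 2 := by nlinarith
  have hD0 : 0 < D := by linarith
  have hT : (g : ℝ) ^ 2 ≤ (g : ℝ) ^ t := pow_le_pow_right₀ (by linarith) ht
  have hNT : (g : ℝ) ^ n ≤ (g : ℝ) ^ t := pow_le_pow_right₀ (by linarith) hnt
  have hN1 : (1 : ℝ) ≤ (g : ℝ) ^ n := one_le_pow₀ (by linarith)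
  rw [zpow_neg, zpow_add₀ (by positivity), zpow_natCast, zpow_natCast]
  -- the scaled error term
  set e : ℝ := (narayana k : ℝ) - a * α ^ k with he
  have hG : ((g : ℝ) - 1) ^ 4 / D ≤ ((g : ℝ) - 1) ^ 2 := by
    rw [div_le_iff₀ hD0]
    nlinarith
  have hG0 : 0 ≤ ((g : ℝ) - 1) ^ 4 / D := by positivity
  have hF : |e * (((g : ℝ) - 1) ^ 4 / D)| ≤ (g : ℝ) ^ t := by
    rw [abs_mul, abs_of_nonneg hG0]
    have : |e| * (((g : ℝ) - 1) ^ 4 / D) ≤ 1 * (((g : ℝ) - 1) ^ 4 / D) :=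
      mul_le_mul_of_nonneg_right herr hG0
    nlinarith
  have hN0 : 0 < (g : ℝ) ^ n := by positivity
  have hT0 : 0 < (g : ℝ) ^ t := by positivity
  have key : a * ((g : ℝ) - 1) ^ 4 / D * α ^ k * ((g : ℝ) ^ n * (g : ℝ) ^ t)⁻¹ - 1
      = (1 - (g : ℝ) ^ n - (g : ℝ) ^ t - e * (((g : ℝ) - 1) ^ 4 / D))
        / ((g : ℝ) ^ n * (g : ℝ) ^ t) := by
    rw [he]
    field_simp
    linear_combination hE
  rw [key, abs_div, abs_of_pos (mul_pos hN0 hT0), div_lt_div_iff₀ (mul_pos hN0 hT0) hN0]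
  have h4 : |1 - (g : ℝ) ^ n - (g : ℝ) ^ t - e * (((g : ℝ) - 1) ^ 4 / D)| < 4 * (g : ℝ) ^ t := by
    rw [abs_le] at hF
    rw [abs_lt]
    constructor <;> linarith [hF.1, hF.2]
  nlinarith
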